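/- arXiv:2312.13207 — 2 statements merged into one kernel-verified Lean document; each statement's English description precedes it below -/
import Mathlib

section
/- Let V ⊆ V(G) be nonempty and let d be a divisor of degree d on G. Then d is V-reduced if and only if there exists an ℝ-divisor E of degree d, supported on V, such that d is E-reduced. -/
open Finset

variable {V : Type*}

/-- The simple graph underlying the multigraph given by the symmetric
edge-multiplicity function `m` (loops are irrelevant for this graph). -/
def graphOf (m : V → V → ℕ) : SimpleGraph V :=
  SimpleGraph.fromRel fun a b => 0 < m a b

/-- The principal divisor of an integer-valued function `f`:
its value at `v` is the sum over all edges `e = vw` of `f w - f v` (loops contribute 0). -/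
def divOf [Fintype V] (m : V → V → ℕ) (f : V → ℤ) : V → ℤ :=
  fun v => ∑ w, (m v w : ℤ) * (f w - f v)

/-- The principal divisor of a real-valued function. -/
def rDivOf [Fintype V] (m : V → V → ℕ) (f : V → ℝ) : V → ℝ :=
  fun v => ∑ w, (m v w : ℝ) * (f w - f v)

/-- The (integer-valued) indicator function of a set of vertices. -/
noncomputable def ind (W : Set V) : V → ℤ := W.indicator 1

/-- Two divisors are linearly equivalent if they differ by a principal divisor. -/
def LinEquiv [Fintype V] (m : V → V → ℕ) (d e : V → ℤ) : Prop :=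
  ∃ f : V → ℤ, ∀ v, d v - e v = divOf m f v

/-- A divisor is `S`-reduced if it is effective away from `S` and chip-firing along any
nonempty `W` disjoint from `S` turns it negative at some vertex of `W`. -/
def VReduced [Fintype V] (m : V → V → ℕ) (S : Set V) (d : V → ℤ) : Prop :=
  (∀ v ∉ S, 0 ≤ d v) ∧
    ∀ W : Set V, W.Nonempty → W ⊆ Sᶜ →
      ∃ w ∈ W, d w + divOf m (ind W) w < 0

/-- One step of the Dhar iteration: add to `A` those vertices outside `A` at which
chip-firing along the complement of `A` makes `d` negative. -/
def dharStep [Fintype V] (m : V → V → ℕ) (d : V → ℤ) (A : Set V) : Set V :=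
  A ∪ {v | v ∉ A ∧ d v + divOf m (ind Aᶜ) v < 0}

/-- The Dhar iteration starting at `S`. -/
def dharIter [Fintype V] (m : V → V → ℕ) (d : V → ℤ) (S : Set V) : ℕ → Set V
  | 0 => S
  | n + 1 => dharStep m d (dharIter m d S n)

/-- The Dhar set `W_Dhar(d, S)`: the complement of the stabilized Dhar iteration
(the increasing iteration is certainly stable after `Fintype.card V` steps). -/
def dharSet [Fintype V] (m : V → V → ℕ) (d : V → ℤ) (S : Set V) : Set V :=
  (dharIter m d S (Fintype.card V))ᶜ

/-- `q` is the function `q_E(D)`: `E = D + div q` and the minimum value of `q` is `0`.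
On a connected graph such a function exists and is unique. -/
def IsQRep [Fintype V] (m : V → V → ℕ) (E D : V → ℝ) (q : V → ℝ) : Prop :=
  (∀ v, E v = D v + rDivOf m q v) ∧ (∀ v, 0 ≤ q v) ∧ (∃ v, q v = 0)

/-- The valence of a vertex: the number of edge-endpoints at `v`, loops counted twice. -/
def valence [Fintype V] (m : V → V → ℕ) (v : V) : ℕ := (∑ w, m v w) + m v v

/-- The number of non-loop edges adjacent to a vertex. -/
def valwl [Fintype V] [DecidableEq V] (m : V → V → ℕ) (v : V) : ℕ :=
  ∑ w ∈ Finset.univ.erase v, m v w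

/-- The canonical divisor of a vertex-weighted graph. -/
def canon [Fintype V] (m : V → V → ℕ) (g : V → ℕ) (v : V) : ℤ :=
  2 * (g v : ℤ) - 2 + (valence m v : ℤ)

/-- A divisor class (given by a representative `d₀`) is special if it is effective
and its residual class is effective. -/
def Special [Fintype V] (m : V → V → ℕ) (g : V → ℕ) (d₀ : V → ℤ) : Prop :=
  (∃ e : V → ℤ, LinEquiv m d₀ e ∧ ∀ v, 0 ≤ e v) ∧
    (∃ e : V → ℤ, LinEquiv m (fun v => canon m g v - d₀ v) e ∧ ∀ v, 0 ≤ e v)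

/-- A divisor is uniform if it and its residual are effective. -/
def Uniform [Fintype V] (m : V → V → ℕ) (g : V → ℕ) (d : V → ℤ) : Prop :=
  ∀ v, 0 ≤ d v ∧ d v ≤ canon m g v

/-- The distance from a vertex to a set of vertices in the underlying graph. -/
noncomputable def distToSet [Fintype V] (m : V → V → ℕ) (S : Set V) (v : V) : ℕ :=
  sInf ((fun s => (graphOf m).dist v s) '' S)

/-- A divisor `d` is `E`-reduced (for an ℝ-divisor `E` supported on `S`) if it is effective
away from `S` and `∑ q_E(d)` is minimal among all divisors linearly equivalent to `d`
and effective away from `S`. -/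
def EReduced [Fintype V] (m : V → V → ℕ) (S : Set V) (E : V → ℝ) (d : V → ℤ) : Prop :=
  (∀ v ∉ S, 0 ≤ d v) ∧
    ∀ q : V → ℝ, IsQRep m E (fun v => (d v : ℝ)) q →
      ∀ d' : V → ℤ, LinEquiv m d d' → (∀ v ∉ S, 0 ≤ d' v) →
        ∀ q' : V → ℝ, IsQRep m E (fun v => (d' v : ℝ)) q' →
          ∑ v, q v ≤ ∑ v, q' v

theorem aux_min [Fintype V] (m : V → V → ℕ) (hsym : ∀ a b, m a b = m b a)
    (hconn : (graphOf m).Connected) (S : Set V) (hS : S.Nonempty) (q : V → ℝ)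
    (hq : ∀ v, v ∉ S → rDivOf m q v ≤ 0) : ∃ s ∈ S, ∀ v, q s ≤ q v := by
  obtain ⟨s0, hs0⟩ := hS
  haveI : Nonempty V := ⟨s0⟩
  obtain ⟨v0, hv0⟩ := Finite.exists_min q
  by_contra hcon
  have hnot : ∀ s ∈ S, q s ≠ q v0 := by
    intro s hs h
    exact hcon ⟨s, hs, fun v => h ▸ hv0 v⟩
  have hstep : ∀ a b, (graphOf m).Adj a b → q a = q v0 → q b = q v0 := by
    intro a b hab ha
    have haS : a ∉ S := fun h => hnot a h ha
    have h1 := hq a haS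
    have hterm : ∀ w ∈ (Finset.univ : Finset V), 0 ≤ (m a w : ℝ) * (q w - q a) := by
      intro w _
      exact mul_nonneg (Nat.cast_nonneg _) (by have := hv0 w; linarith)
    have h0 : ∑ w, (m a w : ℝ) * (q w - q a) = 0 :=
      le_antisymm h1 (Finset.sum_nonneg hterm)
    have hb := (Finset.sum_eq_zero_iff_of_nonneg hterm).1 h0 b (Finset.mem_univ b)
    have hm : 0 < m a b := by
      have h2 := hab
      simp only [graphOf, SimpleGraph.fromRel_adj] at h2
      rcases h2.2 with h | h
      · exact h
      · rw [hsym]; exact h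
    have hm' : (m a b : ℝ) ≠ 0 := by exact_mod_cast hm.ne'
    rcases mul_eq_zero.1 hb with h | h
    · exact absurd h hm'
    · linarith
  have hreach : ∀ b, q b = q v0 := by
    intro b
    obtain ⟨p⟩ := hconn.preconnected v0 b
    have : ∀ (x y : V), (graphOf m).Walk x y → q x = q v0 → q y = q v0 := by
      intro x y p
      induction p with
      | nil => exact id
      | cons h _ ih => exact fun hx => ih (hstep _ _ h hx)
    exact this _ _ p rfl
  exact hnot s0 hs0 (hreach s0)

theorem rDivOf_add [Fintype V] (m : V → V → ℕ) (f g : V → ℝ) (v : V) :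
    rDivOf m (fun x => f x + g x) v = rDivOf m f v + rDivOf m g v := by
  simp only [rDivOf, ← Finset.sum_add_distrib]
  exact Finset.sum_congr rfl fun w _ => by ring

theorem rDivOf_smul [Fintype V] (m : V → V → ℕ) (c : ℝ) (f : V → ℝ) (v : V) :
    rDivOf m (fun x => c * f x) v = c * rDivOf m f v := by
  simp only [rDivOf, Finset.mul_sum]
  exact Finset.sum_congr rfl fun w _ => by ring

theorem rDivOf_sub [Fintype V] (m : V → V → ℕ) (f g : V → ℝ) (v : V) :
    rDivOf m (fun x => f x - g x) v = rDivOf m f v - rDivOf m g v := by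
  simp only [rDivOf, ← Finset.sum_sub_distrib]
  exact Finset.sum_congr rfl fun w _ => by ring

theorem rDivOf_sub_const [Fintype V] (m : V → V → ℕ) (f : V → ℝ) (c : ℝ) (v : V) :
    rDivOf m (fun x => f x - c) v = rDivOf m f v := by
  simp only [rDivOf]
  exact Finset.sum_congr rfl fun w _ => by ring

theorem rDivOf_cast [Fintype V] (m : V → V → ℕ) (f : V → ℤ) (v : V) :
    rDivOf m (fun x => (f x : ℝ)) v = (divOf m f v : ℝ) := by
  simp only [rDivOf, divOf]
  push_cast
  rfl

theorem rDivOf_sum [Fintype V] (m : V → V → ℕ) (hsym : ∀ a b, m a b = m b a) (f : V → ℝ) :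
    ∑ v, rDivOf m f v = 0 := by
  have h : ∑ v, rDivOf m f v = - ∑ v, rDivOf m f v := by
    conv_lhs => simp only [rDivOf]
    rw [Finset.sum_comm, ← Finset.sum_neg_distrib]
    refine Finset.sum_congr rfl fun v _ => ?_
    simp only [rDivOf, ← Finset.sum_neg_distrib]
    refine Finset.sum_congr rfl fun w _ => ?_
    rw [hsym w v]; ring
  linarith

theorem aux_const [Fintype V] (m : V → V → ℕ) (hsym : ∀ a b, m a b = m b a)
    (hconn : (graphOf m).Connected) (q : V → ℝ) (hq : ∀ v, rDivOf m q v = 0) (a b : V) :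
    q a = q b := by
  have key : ∀ a b, q a ≤ q b := by
    intro a b
    obtain ⟨s, hs, h⟩ := aux_min m hsym hconn {a} ⟨a, rfl⟩ q (fun v _ => (hq v).le)
    rw [Set.mem_singleton_iff] at hs
    subst hs
    exact h b
  exact le_antisymm (key a b) (key b a)

open Classical in
theorem aux_dirichlet [Fintype V] (m : V → V → ℕ) (hsym : ∀ a b, m a b = m b a)
    (hconn : (graphOf m).Connected) (S : Set V) (hS : S.Nonempty) (r : V → ℝ) :
    ∃ q : V → ℝ, (∀ v ∈ S, q v = 0) ∧ ∀ v, v ∉ S → rDivOf m q v = r v := by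
  let T : (V → ℝ) →ₗ[ℝ] (V → ℝ) :=
    { toFun := fun f v => if v ∈ S then f v else rDivOf m f v
      map_add' := by
        intro f g
        funext v
        by_cases hv : v ∈ S
        · simp [hv]
        · simp only [hv, if_false, Pi.add_apply]
          exact rDivOf_add m f g v
      map_smul' := by
        intro c f
        funext v
        by_cases hv : v ∈ S
        · simp [hv]
        · simp only [hv, if_false, Pi.smul_apply, RingHom.id_apply, smul_eq_mul]
          exact rDivOf_smul m c f v }
  have hTdef : ∀ f v, T f v = if v ∈ S then f v else rDivOf m f v := fun _ _ => rfl
  have hinj : Function.Injective T := by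
    rw [injective_iff_map_eq_zero]
    intro f hf
    have h1 : ∀ v ∈ S, f v = 0 := by
      intro v hv
      have := congrFun hf v
      rw [hTdef, if_pos hv] at this
      exact this
    have h2 : ∀ v, v ∉ S → rDivOf m f v = 0 := by
      intro v hv
      have := congrFun hf v
      rw [hTdef, if_neg hv] at this
      exact this
    obtain ⟨s, hs, h3⟩ := aux_min m hsym hconn S hS f (fun v hv => (h2 v hv).le)
    obtain ⟨t, ht, h4⟩ := aux_min m hsym hconn S hS (fun x => (-1) * f x)
      (fun v hv => by rw [rDivOf_smul, h2 v hv]; simp)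
    funext v
    have h5 := h3 v
    have h6 := h4 v
    rw [h1 s hs] at h5
    simp only [h1 t ht] at h6
    show f v = 0
    linarith
  obtain ⟨q, hq⟩ := (LinearMap.injective_iff_surjective.1 hinj) (fun v => if v ∈ S then 0 else r v)
  refine ⟨q, fun v hv => ?_, fun v hv => ?_⟩
  · have := congrFun hq v
    rw [hTdef, if_pos hv] at this
    simpa [hv] using this
  · have := congrFun hq v
    rw [hTdef, if_neg hv] at this
    simpa [hv] using this

theorem aux_exists [Fintype V] (m : V → V → ℕ) (hsym : ∀ a b, m a b = m b a)
    (hconn : (graphOf m).Connected) (E D : V → ℝ) (hdeg : ∑ v, E v = ∑ v, D v) :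
    ∃ q, IsQRep m E D q := by
  classical
  haveI := hconn.nonempty
  obtain ⟨s0⟩ := hconn.nonempty
  obtain ⟨q, -, hq⟩ := aux_dirichlet m hsym hconn {s0} ⟨s0, rfl⟩ (fun v => E v - D v)
  have hq' : ∀ v, rDivOf m q v = E v - D v := by
    intro v
    by_cases hv : v = s0
    · subst hv
      have h1 : ∑ w, (rDivOf m q w - (E w - D w)) = 0 := by
        rw [Finset.sum_sub_distrib, rDivOf_sum m hsym, Finset.sum_sub_distrib, hdeg]; ring
      rw [Finset.sum_eq_single v] at h1
      · linarith
      · intro b _ hb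
        rw [hq b (by simpa using hb)]; ring
      · intro h; exact absurd (Finset.mem_univ v) h
    · exact hq v (by simpa using hv)
  obtain ⟨v0, hv0⟩ := Finite.exists_min q
  refine ⟨fun x => q x - q v0, fun v => ?_, fun v => ?_, v0, ?_⟩
  · rw [rDivOf_sub_const, hq']; ring
  · have := hv0 v; simp only; linarith
  · simp

/-- The minimum of a `q`-representation is attained on `S`. -/
theorem aux_zero [Fintype V] (m : V → V → ℕ) (hsym : ∀ a b, m a b = m b a)
    (hconn : (graphOf m).Connected) (S : Set V) (hS : S.Nonempty) (E : V → ℝ)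
    (hE : ∀ v, E v ≠ 0 → v ∈ S) (d : V → ℤ) (hd : ∀ v ∉ S, 0 ≤ d v) (q : V → ℝ)
    (hq : IsQRep m E (fun v => (d v : ℝ)) q) : ∃ s ∈ S, q s = 0 := by
  obtain ⟨h1, h2, v0, h3⟩ := hq
  obtain ⟨s, hs, h⟩ := aux_min m hsym hconn S hS q (by
    intro v hv
    have hEv : E v = 0 := by
      by_contra h; exact hv (hE v h)
    have h4 := h1 v
    have h5 : (0 : ℝ) ≤ d v := by exact_mod_cast hd v hv
    simp only [hEv] at h4
    linarith)
  exact ⟨s, hs, le_antisymm (h3 ▸ h v0) (h2 s)⟩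

open Classical in
theorem ind_apply_aux (W : Set V) (v : V) : ind W v = if v ∈ W then 1 else 0 := by
  simp [ind, Set.indicator_apply]

/-- Main theorem. -/
theorem stmt13 [Fintype V] (m : V → V → ℕ) (hsym : ∀ a b, m a b = m b a)
    (hconn : (graphOf m).Connected) (S : Set V) (hS : S.Nonempty) (d : V → ℤ) :
    VReduced m S d ↔
      ∃ E : V → ℝ, (∑ v, E v = ∑ v, (d v : ℝ)) ∧ (∀ v, E v ≠ 0 → v ∈ S) ∧
        EReduced m S E d := by
  classical
  constructor
  · rintro ⟨heff, hred⟩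
    obtain ⟨q, hq0, hq1⟩ := aux_dirichlet m hsym hconn S hS (fun v => -(d v : ℝ))
    have hEsupp : ∀ v, (d v : ℝ) + rDivOf m q v ≠ 0 → v ∈ S := by
      intro v h
      by_contra hv
      exact h (by rw [hq1 v hv]; ring)
    refine ⟨fun v => (d v : ℝ) + rDivOf m q v, ?_, hEsupp, heff, ?_⟩
    · rw [Finset.sum_add_distrib, rDivOf_sum m hsym, add_zero]
    intro q1 hq1rep d' ⟨f, hf⟩ hd' q' hq'
    obtain ⟨s1, hs1, hs1z⟩ := aux_zero m hsym hconn S hS _ hEsupp d heff q1 hq1rep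
    obtain ⟨s0, hs0, hs0z⟩ := aux_zero m hsym hconn S hS _ hEsupp d' hd' q' hq'
    -- q1 = q
    have hq1q : ∀ v, q1 v = q v := by
      intro v
      have := aux_const m hsym hconn (fun x => q1 x - q x) (by
        intro v
        rw [rDivOf_sub]
        have := hq1rep.1 v
        simp only at this
        linarith) v s1
      simp only [hs1z, hq0 s1 hs1] at this
      linarith
    -- q' = q + f - f s0
    have hq'q : ∀ v, q' v = q v + ((f v - f s0 : ℤ) : ℝ) := by
      intro v
      have := aux_const m hsym hconn (fun x => q' x - (q x + (f x : ℝ))) (by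
        intro v
        rw [rDivOf_sub, rDivOf_add, rDivOf_cast, ← hf v]
        have := hq'.1 v
        simp only at this
        push_cast
        linarith) v s0
      simp only [hs0z, hq0 s0 hs0] at this
      push_cast
      linarith
    have hSnn : ∀ s ∈ S, f s0 ≤ f s := by
      intro s hs
      have h1 := hq'.2.1 s
      rw [hq'q s, hq0 s hs, zero_add] at h1
      have : (0 : ℤ) ≤ f s - f s0 := by exact_mod_cast h1
      linarith
    have hall : ∀ v, f s0 ≤ f v := by
      haveI : Nonempty V := ⟨s0⟩
      obtain ⟨v0, hv0⟩ := Finite.exists_min f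
      by_contra hcon
      push Not at hcon
      obtain ⟨u, hu⟩ := hcon
      obtain ⟨w, hw, hneg⟩ := hred {v | f v = f v0} ⟨v0, rfl⟩ (by
        intro v hv hvS
        have h1 := hSnn v hvS
        have h2 := hv0 u
        have h3 : f v = f v0 := hv
        omega)
      have hw' : f w = f v0 := hw
      have hwS : w ∉ S := by
        intro hwS
        have h1 := hSnn w hwS
        have h2 := hv0 u
        omega
      have h1 := hd' w hwS
      have h2 := hf w
      have h3 : -divOf m (ind {v | f v = f v0}) w ≤ divOf m f w := by
        simp only [divOf, ← Finset.sum_neg_distrib]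
        refine Finset.sum_le_sum fun x _ => ?_
        rw [← mul_neg]
        refine mul_le_mul_of_nonneg_left ?_ (Int.natCast_nonneg _)
        rw [ind_apply_aux, ind_apply_aux, if_pos hw]
        have h4 := hv0 x
        split_ifs with hx
        · have hx' : f x = f v0 := hx
          omega
        · have hx' : f x ≠ f v0 := hx
          omega
      omega
    refine Finset.sum_le_sum fun v _ => ?_
    rw [hq1q, hq'q]
    have : (0 : ℝ) ≤ ((f v - f s0 : ℤ) : ℝ) := by
      have := hall v
      exact_mod_cast (by omega : (0 : ℤ) ≤ f v - f s0)
    linarith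
  · rintro ⟨E, hdeg, hsupp, heff, hmin⟩
    refine ⟨heff, fun W hW hWS => ?_⟩
    by_contra hcon
    push Not at hcon
    obtain ⟨q, hq⟩ := aux_exists m hsym hconn E (fun v => (d v : ℝ)) hdeg
    have hd' : ∀ v ∉ S, 0 ≤ d v + divOf m (ind W) v := by
      intro v hv
      by_cases hvW : v ∈ W
      · exact hcon v hvW
      · refine add_nonneg (heff v hv) (Finset.sum_nonneg fun w _ => ?_)
        refine mul_nonneg (Int.natCast_nonneg _) ?_
        rw [ind_apply_aux, ind_apply_aux, if_neg hvW]
        split_ifs <;> simp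
    have hlin : LinEquiv m d (fun v => d v + divOf m (ind W) v) := by
      refine ⟨fun v => - ind W v, fun v => ?_⟩
      simp only [divOf]
      rw [sub_add_cancel_left, ← Finset.sum_neg_distrib]
      exact Finset.sum_congr rfl fun w _ => by ring
    have hdeg' : ∑ v, E v = ∑ v, ((d v + divOf m (ind W) v : ℤ) : ℝ) := by
      simp only [Int.cast_add, Finset.sum_add_distrib, ← rDivOf_cast]
      rw [rDivOf_sum m hsym, hdeg, add_zero]
    obtain ⟨q', hq'⟩ := aux_exists m hsym hconn E _ hdeg'
    have hle := hmin q hq _ hlin hd' q' hq'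
    obtain ⟨s, hs, hsz⟩ := aux_zero m hsym hconn S hS E hsupp d heff q hq
    obtain ⟨t, ht, htz⟩ := aux_zero m hsym hconn S hS E hsupp _ hd' q' hq'
    have hconst := aux_const m hsym hconn (fun x => q' x - (q x - (ind W x : ℝ))) (by
      intro v
      rw [rDivOf_sub, rDivOf_sub, rDivOf_cast]
      have h1 := hq.1 v
      have h2 := hq'.1 v
      push_cast at h1 h2
      linarith)
    have hindS : ∀ x ∈ S, ind W x = 0 := by
      intro x hx
      rw [ind_apply_aux, if_neg (fun h => hWS h hx)]
    have h1 := hconst s t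
    simp only [hindS s hs, hindS t ht, hsz, htz] at h1
    have h2 := hq'.2.1 s
    have h3 := hq.2.1 t
    push_cast at h1
    have hqt : q t = 0 := by linarith
    have heq : ∀ v, q' v = q v - (ind W v : ℝ) := by
      intro v
      have h4 := hconst v t
      simp only [hindS t ht, htz, hqt] at h4
      push_cast at h4
      linarith
    obtain ⟨w, hw⟩ := hW
    have hlt : ∑ v, q' v < ∑ v, q v := by
      refine Finset.sum_lt_sum (fun v _ => ?_) ⟨w, Finset.mem_univ w, ?_⟩
      · rw [heq, ind_apply_aux]
        split_ifs <;> simp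
      · rw [heq, ind_apply_aux, if_pos hw]
        simp
    linarith
end

section
/- Let δ be a special divisor class on G. Then δ contains a representative d such that for every vertex v ∈ V(G): 0 ≤ d_v ≤ max{val_wl(v) − 1, 2g_v − 2 + val(v)}. -/
open Finset

variable {V : Type*}

theorem divOf_add' [Fintype V] (m : V → V → ℕ) (f h : V → ℤ) (v : V) :
    divOf m (fun w => f w + h w) v = divOf m f v + divOf m h v := by
  unfold divOf
  rw [← Finset.sum_add_distrib]
  exact Finset.sum_congr rfl fun w _ => by ring

theorem divOf_sub' [Fintype V] (m : V → V → ℕ) (f h : V → ℤ) (v : V) :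
    divOf m (fun w => f w - h w) v = divOf m f v - divOf m h v := by
  unfold divOf
  rw [← Finset.sum_sub_distrib]
  exact Finset.sum_congr rfl fun w _ => by ring

theorem divOf_const' [Fintype V] (m : V → V → ℕ) (c : ℤ) (v : V) :
    divOf m (fun _ => c) v = 0 := by
  simp [divOf]

theorem divOf_single_self [Fintype V] [DecidableEq V] (m : V → V → ℕ) (v : V) :
    divOf m (fun w => if w = v then 1 else 0) v = - (valwl m v : ℤ) := by
  unfold divOf valwl
  rw [← Finset.add_sum_erase _ _ (Finset.mem_univ v)]
  push_cast
  rw [← Finset.sum_neg_distrib]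
  simp only [if_true, sub_self, mul_zero, zero_add]
  refine Finset.sum_congr rfl fun w hw => ?_
  rw [if_neg (Finset.ne_of_mem_erase hw)]
  ring

theorem divOf_nonneg_of_min [Fintype V] (m : V → V → ℕ) (f : V → ℤ) (v : V)
    (h : ∀ w, f v ≤ f w) : 0 ≤ divOf m f v := by
  unfold divOf
  exact Finset.sum_nonneg fun w _ =>
    mul_nonneg (Int.natCast_nonneg _) (sub_nonneg.2 (h w))

theorem main_aux [Fintype V] [DecidableEq V] (m : V → V → ℕ) (g : V → ℕ) (d₀ : V → ℤ) (n : ℕ) :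
    ∀ d f : V → ℤ, (∀ v, 0 ≤ d v) → (∀ v, 0 ≤ f v) → ∑ v, f v ≤ n → LinEquiv m d₀ d →
      (∀ v, d v + divOf m f v ≤ canon m g v) →
    ∃ d : V → ℤ, LinEquiv m d₀ d ∧
      ∀ v, 0 ≤ d v ∧
        d v ≤ max ((valwl m v : ℤ) - 1) (2 * (g v : ℤ) - 2 + (valence m v : ℤ)) := by
  induction n with
  | zero =>
    intro d f hd hf hs hl hk
    refine ⟨d, hl, fun v => ⟨hd v, le_max_of_le_right ?_⟩⟩
    have h0 : ∀ w, f w = 0 := fun w => by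
      have := Finset.single_le_sum (f := f) (fun i _ => hf i) (Finset.mem_univ w)
      have := hf w
      push_cast at hs
      omega
    have h1 := hk v
    have h2 := divOf_nonneg_of_min m f v (fun w => by rw [h0, h0])
    unfold canon at h1
    omega
  | succ n ih =>
    intro d f hd hf hs hl hk
    by_cases hB : ∀ v, d v ≤ max ((valwl m v : ℤ) - 1) (2 * (g v : ℤ) - 2 + (valence m v : ℤ))
    · exact ⟨d, hl, fun v => ⟨hd v, hB v⟩⟩
    push Not at hB
    obtain ⟨v, hv⟩ := hB
    rw [max_lt_iff] at hv
    have hfv : 1 ≤ f v := by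
      by_contra hlt
      have h0 : f v = 0 := by have := hf v; omega
      have h2 := divOf_nonneg_of_min m f v (fun w => by rw [h0]; exact hf w)
      have h1 := hk v
      unfold canon at h1
      omega
    refine ih (fun w => d w + divOf m (fun w => if w = v then 1 else 0) w)
      (fun w => f w - if w = v then 1 else 0) ?_ ?_ ?_ ?_ ?_
    · intro w
      by_cases hw : w = v
      · subst hw
        simp only [divOf_single_self]
        omega
      · have : 0 ≤ divOf m (fun w => if w = v then 1 else 0) w :=
          divOf_nonneg_of_min m _ w (fun u => by simp only [if_neg hw]; split_ifs <;> simp)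
        have := hd w
        omega
    · intro w
      have := hf w
      split_ifs with hw
      · subst hw; omega
      · omega
    · rw [Finset.sum_sub_distrib]
      simp only [Finset.sum_ite_eq', Finset.mem_univ, if_true]
      push_cast at hs
      omega
    · obtain ⟨f₁, h₁⟩ := hl
      refine ⟨fun w => f₁ w - if w = v then 1 else 0, fun w => ?_⟩
      rw [divOf_sub', ← h₁ w]
      ring
    · intro w
      rw [divOf_sub']
      have := hk w
      linarith

/-- Theorem `thm:main`: every special divisor class contains a
representative `d` with `0 ≤ d v ≤ max (val_wl v - 1) (2 g v - 2 + val v)` at all `v`. -/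
theorem stmt14 [Fintype V] [DecidableEq V] (m : V → V → ℕ) (hsym : ∀ a b, m a b = m b a)
    (hconn : (graphOf m).Connected) (g : V → ℕ) (d₀ : V → ℤ)
    (hspecial : Special m g d₀) :
    ∃ d : V → ℤ, LinEquiv m d₀ d ∧
      ∀ v, 0 ≤ d v ∧ d v ≤ max ((valwl m v : ℤ) - 1) (2 * (g v : ℤ) - 2 + (valence m v : ℤ)) := by
  obtain ⟨⟨e₁, ⟨f₁, h₁⟩, he₁⟩, ⟨e₂, ⟨f₂, h₂⟩, he₂⟩⟩ := hspecial
  have hf : ∀ v, 0 ≤ (f₁ v + f₂ v) + ∑ w, |f₁ w + f₂ w| := fun v => by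
    have := Finset.single_le_sum (f := fun w => |f₁ w + f₂ w|) (fun i _ => abs_nonneg _)
      (Finset.mem_univ v)
    have := neg_abs_le (f₁ v + f₂ v)
    simp only at *
    linarith
  refine main_aux m g d₀ (∑ v, ((f₁ v + f₂ v) + ∑ w, |f₁ w + f₂ w|)).toNat e₁
    (fun v => (f₁ v + f₂ v) + ∑ w, |f₁ w + f₂ w|) he₁ hf (Int.self_le_toNat _) ⟨f₁, h₁⟩ ?_
  intro v
  rw [divOf_add' m (fun v => f₁ v + f₂ v), divOf_add', divOf_const']
  have a := h₁ v
  have b := h₂ v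
  have c := he₂ v
  simp only at b
  linarith
end
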